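/- arXiv:1904.05481 — 3 statements merged into one kernel-verified Lean document; each statement's English description precedes it below -/
import Mathlib

section
/- Let p be a monotone transition probability function, let (E,⪰) be a partially ordered set, and let g : S × E → A be such that g(·,e) is a bounded measurable policy function for each e ∈ E, g(s,·) is increasing in e for every s ∈ S, and g(·,e₂) is increasing in s. Fix e₁, e₂ ∈ E with e₂ ⪰ e₁ and an initial state s(1) ∈ S, and let μᵢᵗ be the state distributions induced by the kernel Pᵢ(s,·) = p(s, g(s,eᵢ), ·) from s(1). Then ∫_S g(s,e₂) μ₂ᵗ(ds) ≥ ∫_S g(s,e₁) μ₁ᵗ(ds) for all t ∈ ℕ. -/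
set_option autoImplicit false

open MeasureTheory

/-- State distributions induced by a Markov kernel `P` from initial state `s0`:
`iterDist P s0 0 = δ_{s0}` (period 1) and `μ^{t+1}(B) = ∫ P(s,B) μ^t(ds)`. -/
noncomputable def iterDist {α : Type*} [MeasurableSpace α]
    (P : α → Measure α) (s0 : α) : ℕ → Measure α
  | 0 => Measure.dirac s0
  | t + 1 => (iterDist P s0 t).bind P

open ProbabilityTheory in
theorem isProbabilityMeasure_iterDist {α : Type*} [MeasurableSpace α]
    (κ : Kernel α α) [IsMarkovKernel κ] (s : α) (t : ℕ) :
    IsProbabilityMeasure (iterDist κ s t) := by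
  induction t with
  | zero => exact inferInstanceAs (IsProbabilityMeasure (Measure.dirac s))
  | succ t ih => exact inferInstanceAs (IsProbabilityMeasure ((iterDist κ s t).bind κ))

theorem integrable_of_abs_le {α : Type*} [MeasurableSpace α] {μ : Measure α} [IsFiniteMeasure μ]
    {f : α → ℝ} (hf : Measurable f) (hb : ∃ C : ℝ, ∀ x, |f x| ≤ C) : Integrable f μ :=
  let ⟨C, hC⟩ := hb
  Integrable.of_bound hf.aestronglyMeasurable C (ae_of_all _ hC)

open ProbabilityTheory in
theorem integral_bind_kernel {α β : Type*} [MeasurableSpace α] [MeasurableSpace β]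
    {μ : Measure α} {κ : Kernel α β} {f : β → ℝ} (hf : Integrable f (μ.bind κ)) :
    ∫ y, f y ∂μ.bind κ = ∫ x, ∫ y, f y ∂κ x ∂μ := by
  rw [Measure.comp_eq_comp_const_apply] at hf ⊢
  rw [Kernel.integral_comp hf, Kernel.const_apply]

open ProbabilityTheory in
/-- If `κ₂` preserves bounded increasing functions and dominates `κ₁` on them, then the state
distributions of `κ₂` dominate those of `κ₁` in the increasing order. -/
theorem integral_iterDist_mono {α : Type*} [MeasurableSpace α] [Preorder α]
    (κ₁ κ₂ : Kernel α α) [IsMarkovKernel κ₁] [IsMarkovKernel κ₂]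
    (hmono : ∀ f : α → ℝ, Measurable f → Monotone f → (∃ C : ℝ, ∀ x, |f x| ≤ C) →
      Monotone fun s => ∫ x, f x ∂κ₂ s)
    (hle : ∀ f : α → ℝ, Measurable f → Monotone f → (∃ C : ℝ, ∀ x, |f x| ≤ C) →
      ∀ s, ∫ x, f x ∂κ₁ s ≤ ∫ x, f x ∂κ₂ s)
    (s : α) (t : ℕ) {f : α → ℝ} (hf : Measurable f) (hfm : Monotone f)
    (hb : ∃ C : ℝ, ∀ x, |f x| ≤ C) :
    ∫ x, f x ∂iterDist κ₁ s t ≤ ∫ x, f x ∂iterDist κ₂ s t := by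
  induction t generalizing f with
  | zero => exact le_rfl
  | succ t ih =>
    have h₁ := isProbabilityMeasure_iterDist κ₁ s t
    have h₂ := isProbabilityMeasure_iterDist κ₂ s t
    have hmeas (κ : Kernel α α) [IsMarkovKernel κ] : Measurable fun s => ∫ x, f x ∂κ s :=
      (hf.stronglyMeasurable.integral_kernel (κ := κ)).measurable
    have hbdd (κ : Kernel α α) [IsMarkovKernel κ] :
        ∃ C : ℝ, ∀ s, |∫ x, f x ∂κ s| ≤ C := by
      obtain ⟨C, hC⟩ := hb
      refine ⟨C, fun s => ?_⟩
      simpa using norm_integral_le_of_norm_le_const (μ := κ s) (f := f) (ae_of_all _ hC)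
    change ∫ x, f x ∂(iterDist κ₁ s t).bind κ₁ ≤ ∫ x, f x ∂(iterDist κ₂ s t).bind κ₂
    rw [integral_bind_kernel (integrable_of_abs_le hf hb),
      integral_bind_kernel (integrable_of_abs_le hf hb)]
    calc ∫ x, ∫ y, f y ∂κ₁ x ∂iterDist κ₁ s t
        ≤ ∫ x, ∫ y, f y ∂κ₂ x ∂iterDist κ₁ s t :=
          integral_mono (integrable_of_abs_le (hmeas κ₁) (hbdd κ₁))
            (integrable_of_abs_le (hmeas κ₂) (hbdd κ₂)) (hle f hf hfm hb)
      _ ≤ ∫ x, ∫ y, f y ∂κ₂ x ∂iterDist κ₂ s t :=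
          ih (hmeas κ₂) (hmono f hf hfm hb) (hbdd κ₂)

/-- Corollary 1: if the policy `g(s,e)` is increasing in `e` for every `s`,
`g(·,e₂)` is increasing in `s`, and the transition probability function `p` is
monotone, then `e₂ ⪰ e₁` implies `𝔼₂ᵗ(g(e₂)) ≥ 𝔼₁ᵗ(g(e₁))` for all `t` and
every initial state. -/
theorem scs_in_parameter
    {n : ℕ} (S : Set (Fin n → ℝ)) (hS : MeasurableSet S)
    (A : Set ℝ)
    {E : Type*} [PartialOrder E]
    (p : S → A → Measure S)
    (hpmeas : Measurable fun sa : S × A => p sa.1 sa.2)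
    (hpprob : ∀ s a, IsProbabilityMeasure (p s a))
    -- `p` is monotone
    (hpmono : ∀ f : S → ℝ, Measurable f → Monotone f → (∃ C : ℝ, ∀ x, |f x| ≤ C) →
      Monotone fun sa : S × A => ∫ x, f x ∂(p sa.1 sa.2))
    (g : S → E → A)
    -- `g(·,e)` is a bounded measurable policy function for each `e`
    (hgmeas : ∀ e, Measurable fun s => (g s e : ℝ))
    (hgbdd : ∀ e, ∃ C : ℝ, ∀ s, |(g s e : ℝ)| ≤ C)
    -- `g(s,·)` is increasing in `e` for every `s`
    (hgE : ∀ s, Monotone (g s))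
    (e₁ e₂ : E) (he : e₁ ≤ e₂)
    -- `g(·,e₂)` is increasing in `s`
    (hgS : Monotone fun s => g s e₂)
    (s1 : S) :
    ∀ t : ℕ,
      ∫ s, (g s e₂ : ℝ) ∂(iterDist (fun s => p s (g s e₂)) s1 t) ≥
        ∫ s, (g s e₁ : ℝ) ∂(iterDist (fun s => p s (g s e₁)) s1 t) := by
  intro t
  let κ (e : E) : ProbabilityTheory.Kernel S S :=
    ⟨fun s => p s (g s e), hpmeas.comp (measurable_id.prodMk (hgmeas e).subtype_mk)⟩
  have hκ (e : E) : ProbabilityTheory.IsMarkovKernel (κ e) := ⟨fun s => hpprob s (g s e)⟩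
  have hint (e : E) : Integrable (fun s => (g s e : ℝ)) (iterDist (κ e₁) s1 t) :=
    have := isProbabilityMeasure_iterDist (κ e₁) s1 t
    integrable_of_abs_le (hgmeas e) (hgbdd e)
  calc ∫ s, (g s e₁ : ℝ) ∂iterDist (κ e₁) s1 t
      ≤ ∫ s, (g s e₂ : ℝ) ∂iterDist (κ e₁) s1 t :=
        integral_mono (hint e₁) (hint e₂) fun s => hgE s he
    _ ≤ ∫ s, (g s e₂ : ℝ) ∂iterDist (κ e₂) s1 t :=
        integral_iterDist_mono (κ e₁) (κ e₂)
          (fun f hf hfm hb _ _ h => hpmono f hf hfm hb (Prod.mk_le_mk.2 ⟨h, hgS h⟩))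
          (fun f hf hfm hb s => hpmono f hf hfm hb (Prod.mk_le_mk.2 ⟨le_rfl, hgE s he⟩))
          s1 t (hgmeas e₂) hgS (hgbdd e₂)
end

section
/- Let p₁, p₂ be transition probability functions with p₂ monotone and p₂ ⪰_st p₁, and let g₁, g₂ : S → A be bounded measurable policy functions with g₂ increasing in s and g₂(s) ≥ g₁(s) for all s ∈ S. For a common initial state s(1) ∈ S, let μᵢᵗ be the state distributions induced by the kernel Pᵢ(s,·) = pᵢ(s,gᵢ(s),·). Then ∫_S g₂ dμ₂ᵗ ≥ ∫_S g₁ dμ₁ᵗ for all t ∈ ℕ. -/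
set_option autoImplicit false

open MeasureTheory

section StochasticOrder

open ProbabilityTheory

variable {α : Type*} [MeasurableSpace α]

theorem iterDist_isProbabilityMeasure {P : α → Measure α} (hP : Measurable P)
    (hprob : ∀ s, IsProbabilityMeasure (P s)) (s0 : α) (t : ℕ) :
    IsProbabilityMeasure (iterDist P s0 t) := by
  induction t with
  | zero => exact Measure.dirac.isProbabilityMeasure
  | succ t ih =>
    exact isProbabilityMeasure_bind hP.aemeasurable (ae_of_all _ hprob)

theorem integrable_of_measurable_of_abs_le {μ : Measure α} [IsFiniteMeasure μ] {f : α → ℝ}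
    (hf : Measurable f) {C : ℝ} (hC : ∀ x, |f x| ≤ C) : Integrable f μ :=
  .of_bound hf.aestronglyMeasurable C (ae_of_all _ hC)

theorem measurable_integral_of_measurable {P : α → Measure α} (hP : Measurable P)
    (hprob : ∀ s, IsProbabilityMeasure (P s)) {f : α → ℝ} (hf : Measurable f) :
    Measurable fun s => ∫ x, f x ∂(P s) :=
  let κ : Kernel α α := ⟨P, hP⟩
  have : IsMarkovKernel κ := ⟨hprob⟩
  (hf.stronglyMeasurable.integral_kernel (κ := κ)).measurable

theorem abs_integral_le_of_abs_le {μ : Measure α} [IsProbabilityMeasure μ] {f : α → ℝ} {C : ℝ}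
    (hC : ∀ x, |f x| ≤ C) : |∫ x, f x ∂μ| ≤ C := by
  simpa using norm_integral_le_of_norm_le_const (μ := μ)
    (ae_of_all _ fun x => (Real.norm_eq_abs (f x)).trans_le (hC x))

theorem integral_iterDist_succ {P : α → Measure α} (hP : Measurable P)
    (hprob : ∀ s, IsProbabilityMeasure (P s)) (s0 : α) (t : ℕ) {f : α → ℝ} (hf : Measurable f)
    {C : ℝ} (hC : ∀ x, |f x| ≤ C) :
    ∫ x, f x ∂(iterDist P s0 (t + 1)) = ∫ s, ∫ x, f x ∂(P s) ∂(iterDist P s0 t) := by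
  have := iterDist_isProbabilityMeasure hP hprob s0 (t + 1)
  let κ : Kernel α α := ⟨P, hP⟩
  have : IsMarkovKernel κ := ⟨hprob⟩
  exact Kernel.integral_comp (η := κ) (κ := Kernel.const Unit (iterDist P s0 t)) (a := ())
    (integrable_of_measurable_of_abs_le (μ := iterDist P s0 (t + 1)) hf hC)

/-- If `P₂` preserves bounded increasing functions and dominates `P₁` stochastically, then the
state distributions it induces dominate those of `P₁`. -/
theorem integral_iterDist_mono_s3 [Preorder α] {P₁ P₂ : α → Measure α}
    (hP₁ : Measurable P₁) (hP₂ : Measurable P₂)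
    (hprob₁ : ∀ s, IsProbabilityMeasure (P₁ s)) (hprob₂ : ∀ s, IsProbabilityMeasure (P₂ s))
    (hmono : ∀ f : α → ℝ, Measurable f → Monotone f → (∃ C : ℝ, ∀ x, |f x| ≤ C) →
      Monotone fun s => ∫ x, f x ∂(P₂ s))
    (hle : ∀ f : α → ℝ, Measurable f → Monotone f → (∃ C : ℝ, ∀ x, |f x| ≤ C) →
      ∀ s, ∫ x, f x ∂(P₁ s) ≤ ∫ x, f x ∂(P₂ s))
    (s0 : α) (t : ℕ) {f : α → ℝ} (hf : Measurable f) (hfmono : Monotone f)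
    (hbdd : ∃ C : ℝ, ∀ x, |f x| ≤ C) :
    ∫ x, f x ∂(iterDist P₁ s0 t) ≤ ∫ x, f x ∂(iterDist P₂ s0 t) := by
  induction t generalizing f with
  | zero => exact le_rfl
  | succ t ih =>
    obtain ⟨C, hC⟩ := hbdd
    have := iterDist_isProbabilityMeasure hP₁ hprob₁ s0 t
    have hF₁ := measurable_integral_of_measurable hP₁ hprob₁ hf
    have hF₂ := measurable_integral_of_measurable hP₂ hprob₂ hf
    have hC₂ : ∀ s, |∫ x, f x ∂(P₂ s)| ≤ C := fun s => abs_integral_le_of_abs_le hC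
    rw [integral_iterDist_succ hP₁ hprob₁ s0 t hf hC, integral_iterDist_succ hP₂ hprob₂ s0 t hf hC]
    calc ∫ s, ∫ x, f x ∂(P₁ s) ∂(iterDist P₁ s0 t)
        ≤ ∫ s, ∫ x, f x ∂(P₂ s) ∂(iterDist P₁ s0 t) :=
          integral_mono
            (integrable_of_measurable_of_abs_le hF₁ fun s => abs_integral_le_of_abs_le hC)
            (integrable_of_measurable_of_abs_le hF₂ hC₂) (hle f hf hfmono ⟨C, hC⟩)
      _ ≤ ∫ s, ∫ x, f x ∂(P₂ s) ∂(iterDist P₂ s0 t) :=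
          ih hF₂ (hmono f hf hfmono ⟨C, hC⟩) ⟨C, hC₂⟩

end StochasticOrder

/-- Theorem 2(i): if `p₂` is monotone, `g₂` is increasing in `s`, and `g₂ ≥ g₁`,
then `p₂ ⪰_st p₁` implies `𝔼₂ᵗ(g₂) ≥ 𝔼₁ᵗ(g₁)` for all `t`. -/
theorem scs_in_transition_st
    {n : ℕ} (S : Set (Fin n → ℝ)) (hS : MeasurableSet S)
    (A : Set ℝ)
    (p₁ p₂ : S → A → Measure S)
    (hp₁meas : Measurable fun sa : S × A => p₁ sa.1 sa.2)
    (hp₂meas : Measurable fun sa : S × A => p₂ sa.1 sa.2)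
    (hp₁prob : ∀ s a, IsProbabilityMeasure (p₁ s a))
    (hp₂prob : ∀ s a, IsProbabilityMeasure (p₂ s a))
    -- `p₂` is monotone
    (hp₂mono : ∀ f : S → ℝ, Measurable f → Monotone f → (∃ C : ℝ, ∀ x, |f x| ≤ C) →
      Monotone fun sa : S × A => ∫ x, f x ∂(p₂ sa.1 sa.2))
    -- `p₂ ⪰_st p₁`
    (hst : ∀ f : S → ℝ, Measurable f → Monotone f → (∃ C : ℝ, ∀ x, |f x| ≤ C) →
      ∀ (s : S) (a : A), ∫ x, f x ∂(p₂ s a) ≥ ∫ x, f x ∂(p₁ s a))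
    (g₁ g₂ : S → A)
    -- bounded measurable policy functions
    (hg₁meas : Measurable fun s => (g₁ s : ℝ))
    (hg₂meas : Measurable fun s => (g₂ s : ℝ))
    (hg₁bdd : ∃ C : ℝ, ∀ s, |(g₁ s : ℝ)| ≤ C)
    (hg₂bdd : ∃ C : ℝ, ∀ s, |(g₂ s : ℝ)| ≤ C)
    -- `g₂` is increasing in `s` and `g₂ ≥ g₁`
    (hg₂mono : Monotone g₂)
    (hge : ∀ s, g₁ s ≤ g₂ s)
    (s1 : S) :
    ∀ t : ℕ,
      ∫ s, (g₂ s : ℝ) ∂(iterDist (fun s => p₂ s (g₂ s)) s1 t) ≥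
        ∫ s, (g₁ s : ℝ) ∂(iterDist (fun s => p₁ s (g₁ s)) s1 t) := by
  intro t
  have hP₁ : Measurable fun s => p₁ s (g₁ s) :=
    hp₁meas.comp (measurable_id.prodMk hg₁meas.subtype_mk)
  have hP₂ : Measurable fun s => p₂ s (g₂ s) :=
    hp₂meas.comp (measurable_id.prodMk hg₂meas.subtype_mk)
  have := iterDist_isProbabilityMeasure hP₁ (fun s => hp₁prob s (g₁ s)) s1 t
  obtain ⟨C₁, hC₁⟩ := hg₁bdd
  obtain ⟨C₂, hC₂⟩ := hg₂bdd
  calc ∫ s, (g₁ s : ℝ) ∂(iterDist (fun s => p₁ s (g₁ s)) s1 t)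
      ≤ ∫ s, (g₂ s : ℝ) ∂(iterDist (fun s => p₁ s (g₁ s)) s1 t) :=
        integral_mono (integrable_of_measurable_of_abs_le hg₁meas hC₁)
          (integrable_of_measurable_of_abs_le hg₂meas hC₂) hge
    _ ≤ ∫ s, (g₂ s : ℝ) ∂(iterDist (fun s => p₂ s (g₂ s)) s1 t) :=
        integral_iterDist_mono_s3 hP₁ hP₂ (fun s => hp₁prob s (g₁ s)) (fun s => hp₂prob s (g₂ s))
          (fun f hf hfm hfb s s' hs => hp₂mono f hf hfm hfb
            (show (s, g₂ s) ≤ (s', g₂ s') from ⟨hs, hg₂mono hs⟩))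
          (fun f hf hfm hfb s => (hst f hf hfm hfb s (g₁ s)).trans
            (hp₂mono f hf hfm hfb (show (s, g₁ s) ≤ (s, g₂ s) from ⟨le_rfl, hge s⟩)))
          s1 t hg₂meas hg₂mono ⟨C₂, hC₂⟩
end

section
/- In the dynamic pricing model with a reference effect and an uncertain memory factor, the expected optimal prices in each period are higher when the initial reference price is higher: if s₂(1) ≥ s₁(1) are two initial reference prices and μᵢᵗ are the state distributions induced by the kernel P(s,·) = p(s,g(s),·) from initial state sᵢ(1), then ∫_S g dμ₂ᵗ ≥ ∫_S g dμ₁ᵗ for all t ∈ ℕ. -/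
set_option autoImplicit false

open MeasureTheory

/-- A solution of the discounted dynamic program on the state set `S` with
feasible-action correspondence `Γ` and Bellman functional `H` (`H f s a = h(s,a,f)`):
`V` is the value function, a fixed point of the Bellman operator `T` with the
maximum attained; `W t = Tᵗ0` are the Bellman iterates of the zero function and
converge pointwise to `V`; `g(s) = max{a ∈ Γ(s) : h(s,a,V) = V(s)}` is the policy
function. -/
structure DPSolution {σ : Type*} (S : Set σ) (Γ : σ → Set ℝ)
    (H : (σ → ℝ) → σ → ℝ → ℝ) where
  V : σ → ℝ
  g : σ → ℝ
  W : ℕ → σ → ℝ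
  W_zero : W 0 = fun _ => 0
  bellman : ∀ s ∈ S, IsGreatest ((fun a => H V s a) '' Γ s) (V s)
  iterate : ∀ t, ∀ s ∈ S, IsGreatest ((fun a => H (W t) s a) '' Γ s) (W (t + 1) s)
  tendstoV : ∀ s ∈ S, Filter.Tendsto (fun t => W t s) Filter.atTop (nhds (V s))
  gmax : ∀ s ∈ S, IsGreatest {a ∈ Γ s | H V s a = V s} (g s)

/-- A convex function on a segment is larger at the outer points than at the inner ones. -/
theorem ConvexOn.map_add_map_le_of_add_eq {f : ℝ → ℝ} {S : Set ℝ} (hf : ConvexOn ℝ S f)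
    {x y z w : ℝ} (hx : x ∈ S) (hw : w ∈ S) (hxy : x ≤ y) (hyw : y ≤ w) (h : x + w = y + z) :
    f y + f z ≤ f x + f w := by
  rcases eq_or_lt_of_le (hxy.trans hyw) with rfl | hlt
  · obtain rfl : x = y := le_antisymm hxy hyw
    obtain rfl : x = z := by linarith
    rfl
  have hpos : 0 < w - x := sub_pos.2 hlt
  obtain ⟨p, q, hp, hq, hpq, rfl⟩ : ∃ p q : ℝ, 0 ≤ p ∧ 0 ≤ q ∧ p + q = 1 ∧ p * x + q * w = y := by
    refine ⟨(w - y) / (w - x), (y - x) / (w - x), div_nonneg (by linarith) hpos.le,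
      div_nonneg (by linarith) hpos.le, ?_, ?_⟩
    · field_simp
      ring
    · field_simp
      ring
  obtain rfl : z = q * x + p * w := by
    linear_combination -h - (x + w) * hpq
  have h₁ := hf.2 hx hw hp hq hpq
  have h₂ := hf.2 hx hw hq hp (by rw [add_comm, hpq])
  simp only [smul_eq_mul] at h₁ h₂
  have h₃ : f x + f w = (p * f x + q * f w) + (q * f x + p * f w) := by
    linear_combination -(f x + f w) * hpq
  linarith

theorem mix_mem_Icc {lo hi x y γ : ℝ} (hγ : γ ∈ Set.Icc (0 : ℝ) 1) (hx : x ∈ Set.Icc lo hi)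
    (hy : y ∈ Set.Icc lo hi) : γ * x + (1 - γ) * y ∈ Set.Icc lo hi :=
  convex_Icc lo hi hx hy hγ.1 (sub_nonneg.2 hγ.2) (add_sub_cancel _ _)

theorem mix_le_mix {x x' y y' γ : ℝ} (hγ : γ ∈ Set.Icc (0 : ℝ) 1) (hx : x ≤ x') (hy : y ≤ y') :
    γ * x + (1 - γ) * y ≤ γ * x' + (1 - γ) * y' :=
  add_le_add (mul_le_mul_of_nonneg_left hx hγ.1)
    (mul_le_mul_of_nonneg_left hy (sub_nonneg.2 hγ.2))

theorem ae_mem_unitInterval {v : Measure ℝ} [IsProbabilityMeasure v]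
    (hv : v (Set.Icc 0 1) = 1) : ∀ᵐ γ ∂v, γ ∈ Set.Icc (0 : ℝ) 1 :=
  (mem_ae_iff_prob_eq_one measurableSet_Icc).2 hv

theorem MonotoneOn.integrable_mix {v : Measure ℝ} [IsProbabilityMeasure v]
    (hv : v (Set.Icc 0 1) = 1) {lo hi : ℝ} {f : ℝ → ℝ} (hf : MonotoneOn f (Set.Icc lo hi))
    {x y : ℝ} (hx : x ∈ Set.Icc lo hi) (hy : y ∈ Set.Icc lo hi) :
    Integrable (fun γ => f (γ * x + (1 - γ) * y)) v := by
  rw [← Measure.restrict_eq_self_of_ae_mem (ae_mem_unitInterval hv)]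
  rcases le_total x y with hxy | hxy
  · refine AntitoneOn.integrableOn_isCompact isCompact_Icc fun γ hγ δ hδ h =>
      hf (mix_mem_Icc hδ hx hy) (mix_mem_Icc hγ hx hy) ?_
    nlinarith
  · refine MonotoneOn.integrableOn_isCompact isCompact_Icc fun γ hγ δ hδ h =>
      hf (mix_mem_Icc hγ hx hy) (mix_mem_Icc hδ hx hy) ?_
    nlinarith

section PricingReturn

variable {lo hi abar : ℝ} {v : Measure ℝ} [IsProbabilityMeasure v] {D : ℝ → ℝ → ℝ} {β : ℝ}
  {f : ℝ → ℝ}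

theorem monotoneOn_pricing_return (hA : Set.Icc 0 abar ⊆ Set.Icc lo hi)
    (hv : v (Set.Icc 0 1) = 1) (hβ : 0 ≤ β) {a : ℝ} (ha : a ∈ Set.Icc 0 abar)
    (hD : MonotoneOn (fun s => D s a) (Set.Icc lo hi)) (hf : MonotoneOn f (Set.Icc lo hi)) :
    MonotoneOn (fun s => a * D s a + β * ∫ γ, f (γ * s + (1 - γ) * a) ∂v) (Set.Icc lo hi) := by
  intro x hx y hy hxy
  refine add_le_add (mul_le_mul_of_nonneg_left (hD hx hy hxy) ha.1)
    (mul_le_mul_of_nonneg_left ?_ hβ)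
  refine integral_mono_ae (hf.integrable_mix hv hx (hA ha)) (hf.integrable_mix hv hy (hA ha)) ?_
  filter_upwards [ae_mem_unitInterval hv] with γ hγ
  exact hf (mix_mem_Icc hγ hx (hA ha)) (mix_mem_Icc hγ hy (hA ha)) (mix_le_mix hγ hxy le_rfl)

theorem convexOn_pricing_return (hA : Set.Icc 0 abar ⊆ Set.Icc lo hi)
    (hv : v (Set.Icc 0 1) = 1) (hβ : 0 ≤ β) {a : ℝ} (ha : a ∈ Set.Icc 0 abar)
    (hD : ConvexOn ℝ (Set.Icc lo hi) (fun s => D s a)) (hf : MonotoneOn f (Set.Icc lo hi))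
    (hfc : ConvexOn ℝ (Set.Icc lo hi) f) :
    ConvexOn ℝ (Set.Icc lo hi)
      (fun s => a * D s a + β * ∫ γ, f (γ * s + (1 - γ) * a) ∂v) := by
  refine (hD.smul ha.1).add (ConvexOn.smul hβ ⟨convex_Icc lo hi, ?_⟩)
  intro x hx y hy p q hp hq hpq
  have ix := hf.integrable_mix hv hx (hA ha)
  have iy := hf.integrable_mix hv hy (hA ha)
  simp only [smul_eq_mul]
  rw [← integral_const_mul, ← integral_const_mul,
    ← integral_add (ix.const_mul p) (iy.const_mul q)]
  refine integral_mono_ae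
    (hf.integrable_mix hv (convex_Icc lo hi hx hy hp hq hpq) (hA ha))
    ((ix.const_mul p).add (iy.const_mul q)) ?_
  filter_upwards [ae_mem_unitInterval hv] with γ hγ
  have h := hfc.2 (mix_mem_Icc hγ hx (hA ha)) (mix_mem_Icc hγ hy (hA ha)) hp hq hpq
  simp only [smul_eq_mul] at h
  refine le_of_eq_of_le (congrArg f ?_) h
  linear_combination -(1 - γ) * a * hpq

theorem pricing_return_increasing_differences (hA : Set.Icc 0 abar ⊆ Set.Icc lo hi)
    (hv : v (Set.Icc 0 1) = 1) (hβ : 0 ≤ β)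
    (hDinc : ∀ a ∈ Set.Icc 0 abar, MonotoneOn (fun s => D s a) (Set.Icc lo hi))
    (hDid : ∀ s₁ ∈ Set.Icc lo hi, ∀ s₂ ∈ Set.Icc lo hi,
      ∀ a₁ ∈ Set.Icc 0 abar, ∀ a₂ ∈ Set.Icc 0 abar, s₁ ≤ s₂ → a₁ ≤ a₂ →
      D s₂ a₂ - D s₂ a₁ ≥ D s₁ a₂ - D s₁ a₁)
    (hf : MonotoneOn f (Set.Icc lo hi)) (hfc : ConvexOn ℝ (Set.Icc lo hi) f)
    {s₁ s₂ a₁ a₂ : ℝ} (hs₁ : s₁ ∈ Set.Icc lo hi) (hs₂ : s₂ ∈ Set.Icc lo hi)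
    (ha₁ : a₁ ∈ Set.Icc 0 abar) (ha₂ : a₂ ∈ Set.Icc 0 abar) (hs : s₁ ≤ s₂) (ha : a₁ ≤ a₂) :
    (a₁ * D s₂ a₁ + β * ∫ γ, f (γ * s₂ + (1 - γ) * a₁) ∂v) +
        (a₂ * D s₁ a₂ + β * ∫ γ, f (γ * s₁ + (1 - γ) * a₂) ∂v) ≤
      (a₁ * D s₁ a₁ + β * ∫ γ, f (γ * s₁ + (1 - γ) * a₁) ∂v) +
        (a₂ * D s₂ a₂ + β * ∫ γ, f (γ * s₂ + (1 - γ) * a₂) ∂v) := by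
  have hint : (∫ γ, f (γ * s₂ + (1 - γ) * a₁) ∂v) + ∫ γ, f (γ * s₁ + (1 - γ) * a₂) ∂v ≤
      (∫ γ, f (γ * s₁ + (1 - γ) * a₁) ∂v) + ∫ γ, f (γ * s₂ + (1 - γ) * a₂) ∂v := by
    have i₁₁ := hf.integrable_mix hv hs₁ (hA ha₁)
    have i₁₂ := hf.integrable_mix hv hs₁ (hA ha₂)
    have i₂₁ := hf.integrable_mix hv hs₂ (hA ha₁)
    have i₂₂ := hf.integrable_mix hv hs₂ (hA ha₂)
    rw [← integral_add i₂₁ i₁₂, ← integral_add i₁₁ i₂₂]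
    refine integral_mono_ae (i₂₁.add i₁₂) (i₁₁.add i₂₂) ?_
    filter_upwards [ae_mem_unitInterval hv] with γ hγ
    exact hfc.map_add_map_le_of_add_eq (mix_mem_Icc hγ hs₁ (hA ha₁))
      (mix_mem_Icc hγ hs₂ (hA ha₂)) (mix_le_mix hγ hs le_rfl) (mix_le_mix hγ le_rfl ha) (by ring)
  have hD₁ : 0 ≤ D s₂ a₁ - D s₁ a₁ := sub_nonneg.2 (hDinc a₁ ha₁ hs₁ hs₂ hs)
  have hD₂ : D s₂ a₁ - D s₁ a₁ ≤ D s₂ a₂ - D s₁ a₂ := by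
    linarith [hDid s₁ hs₁ s₂ hs₂ a₁ ha₁ a₂ ha₂ hs ha]
  have hD₃ := mul_le_mul ha hD₂ hD₁ ha₂.1
  nlinarith [mul_le_mul_of_nonneg_left hint hβ]

end PricingReturn

namespace DPSolution

section Bellman

variable {σ : Type*} {S : Set σ} {A : Set ℝ} {H : (σ → ℝ) → σ → ℝ → ℝ}

theorem monotoneOn_V [Preorder σ] (sol : DPSolution S (fun _ => A) H)
    (hH : ∀ n, MonotoneOn (sol.W n) S → ∀ a ∈ A, MonotoneOn (fun s => H (sol.W n) s a) S) :
    (∀ n, MonotoneOn (sol.W n) S) ∧ MonotoneOn sol.V S := by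
  have hW : ∀ n, MonotoneOn (sol.W n) S := by
    intro n
    induction n with
    | zero => rw [sol.W_zero]; exact monotoneOn_const
    | succ n ih =>
      intro x hx y hy hxy
      obtain ⟨a, ha, hax⟩ := (sol.iterate n x hx).1
      rw [← hax]
      exact (hH n ih a ha hx hy hxy).trans ((sol.iterate n y hy).2 ⟨a, ha, rfl⟩)
  exact ⟨hW, fun x hx y hy hxy =>
    le_of_tendsto_of_tendsto' (sol.tendstoV x hx) (sol.tendstoV y hy) fun n => hW n hx hy hxy⟩

theorem convexOn_V [AddCommGroup σ] [Module ℝ σ] (hS : Convex ℝ S)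
    (sol : DPSolution S (fun _ => A) H)
    (hH : ∀ n, ConvexOn ℝ S (sol.W n) → ∀ a ∈ A, ConvexOn ℝ S (fun s => H (sol.W n) s a)) :
    ConvexOn ℝ S sol.V := by
  have hW : ∀ n, ConvexOn ℝ S (sol.W n) := by
    intro n
    induction n with
    | zero => rw [sol.W_zero]; exact convexOn_const 0 hS
    | succ n ih =>
      refine ⟨hS, fun x hx y hy p q hp hq hpq => ?_⟩
      obtain ⟨a, ha, hax⟩ := (sol.iterate n _ (hS hx hy hp hq hpq)).1
      rw [← hax]
      exact ((hH n ih a ha).2 hx hy hp hq hpq).trans (add_le_add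
        (mul_le_mul_of_nonneg_left ((sol.iterate n x hx).2 ⟨a, ha, rfl⟩) hp)
        (mul_le_mul_of_nonneg_left ((sol.iterate n y hy).2 ⟨a, ha, rfl⟩) hq))
  exact ⟨hS, fun x hx y hy p q hp hq hpq =>
    le_of_tendsto_of_tendsto' (sol.tendstoV _ (hS hx hy hp hq hpq))
      (((sol.tendstoV x hx).const_mul p).add ((sol.tendstoV y hy).const_mul q))
      fun n => (hW n).2 hx hy hp hq hpq⟩

theorem monotoneOn_g [Preorder σ] (sol : DPSolution S (fun _ => A) H)
    (hH : ∀ s₁ ∈ S, ∀ s₂ ∈ S, ∀ a₁ ∈ A, ∀ a₂ ∈ A, s₁ ≤ s₂ → a₁ ≤ a₂ →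
      H sol.V s₂ a₁ + H sol.V s₁ a₂ ≤ H sol.V s₁ a₁ + H sol.V s₂ a₂) :
    MonotoneOn sol.g S := by
  intro x hx y hy hxy
  by_contra! hlt
  obtain ⟨⟨hgx, hVx⟩, -⟩ := sol.gmax x hx
  obtain ⟨⟨hgy, hVy⟩, hmax⟩ := sol.gmax y hy
  have h₁ := hH x hx y hy _ hgy _ hgx hxy hlt.le
  have h₂ : H sol.V x (sol.g y) ≤ sol.V x := (sol.bellman x hx).2 ⟨_, hgy, rfl⟩
  have h₃ : H sol.V y (sol.g x) ≤ sol.V y := (sol.bellman y hy).2 ⟨_, hgx, rfl⟩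
  exact hlt.not_ge (hmax ⟨hgx, le_antisymm h₃ (by linarith)⟩)

end Bellman

end DPSolution

theorem measurable_map_param {α β γ : Type*} [MeasurableSpace α] [MeasurableSpace β]
    [MeasurableSpace γ] {v : Measure γ} [SFinite v] {φ : α → γ → β}
    (hφ : Measurable (Function.uncurry φ)) : Measurable fun s => v.map (φ s) := by
  refine Measure.measurable_of_measurable_coe _ fun B hB => ?_
  have h : (fun s => v.map (φ s) B) = fun s => v (Prod.mk s ⁻¹' (Function.uncurry φ ⁻¹' B)) :=
    funext fun s => Measure.map_apply (hφ.comp measurable_prodMk_left) hB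
  rw [h]
  exact measurable_measure_prodMk_left (hφ hB)

theorem isProbabilityMeasure_iterDist_s12 {α : Type*} [MeasurableSpace α] {P : α → Measure α}
    (hP : Measurable P) (hprob : ∀ s, IsProbabilityMeasure (P s)) (s : α) (t : ℕ) :
    IsProbabilityMeasure (iterDist P s t) := by
  induction t with
  | zero => exact Measure.dirac.isProbabilityMeasure
  | succ t ih =>
    exact isProbabilityMeasure_bind hP.aemeasurable (.of_forall hprob)

/-- A random monotone map preserves first-order stochastic dominance along its iterates. -/
theorem lintegral_iterDist_mono {α γ : Type*} [MeasurableSpace α] [Preorder α]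
    [MeasurableSpace γ] {v : Measure γ} [SFinite v] {φ : α → γ → α} {S : Set α}
    (hφ : Measurable (Function.uncurry φ))
    (hmaps : ∀ᵐ c ∂v, Set.MapsTo (fun s => φ s c) S S)
    (hmono : ∀ᵐ c ∂v, MonotoneOn (fun s => φ s c) S)
    {s₁ s₂ : α} (hs₁ : s₁ ∈ S) (hs₂ : s₂ ∈ S) (hs : s₁ ≤ s₂) (t : ℕ) {f : α → ENNReal}
    (hfm : Measurable f) (hf : MonotoneOn f S) :
    ∫⁻ s, f s ∂(iterDist (fun s => v.map (φ s)) s₁ t) ≤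
      ∫⁻ s, f s ∂(iterDist (fun s => v.map (φ s)) s₂ t) := by
  induction t generalizing f with
  | zero => simpa only [iterDist, lintegral_dirac' _ hfm] using hf hs₁ hs₂ hs
  | succ t ih =>
    have hP := measurable_map_param (v := v) hφ
    simp only [iterDist]
    rw [Measure.lintegral_bind hP.aemeasurable hfm.aemeasurable,
      Measure.lintegral_bind hP.aemeasurable hfm.aemeasurable]
    have hmap : ∀ s, ∫⁻ x, f x ∂(v.map (φ s)) = ∫⁻ c, f (φ s c) ∂v := fun s =>
      lintegral_map hfm (hφ.comp measurable_prodMk_left)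
    simp only [hmap]
    refine ih (hfm.comp hφ).lintegral_prod_right' fun x hx y hy hxy => ?_
    refine lintegral_mono_ae ?_
    filter_upwards [hmaps, hmono] with c hc hc'
    exact hf (hc hx) (hc hy) (hc' hx hy hxy)

/-- Proposition 2(ii) (dynamic pricing with a reference effect and an uncertain
memory factor): the expected optimal prices in each period are higher when the
initial reference price is higher. -/
theorem expected_prices_higher_for_higher_initial_reference_price
    (lo hi abar : ℝ) (hlo : lo ≤ 0) (habar : 0 ≤ abar) (hhi : abar ≤ hi)
    (D : ℝ → ℝ → ℝ)
    (hDcont : Continuous fun q : ℝ × ℝ => D q.1 q.2)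
    (hDnonneg : ∀ s ∈ Set.Icc lo hi, ∀ a ∈ Set.Icc 0 abar, 0 ≤ D s a)
    (hDdec : ∀ s ∈ Set.Icc lo hi, AntitoneOn (fun a => D s a) (Set.Icc 0 abar))
    (hDinc : ∀ a ∈ Set.Icc 0 abar, MonotoneOn (fun s => D s a) (Set.Icc lo hi))
    (hDconv : ∀ a ∈ Set.Icc 0 abar, ConvexOn ℝ (Set.Icc lo hi) (fun s => D s a))
    (hDid : ∀ s₁ ∈ Set.Icc lo hi, ∀ s₂ ∈ Set.Icc lo hi,
      ∀ a₁ ∈ Set.Icc 0 abar, ∀ a₂ ∈ Set.Icc 0 abar, s₁ ≤ s₂ → a₁ ≤ a₂ →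
      D s₂ a₂ - D s₂ a₁ ≥ D s₁ a₂ - D s₁ a₁)
    (v : Measure ℝ) (hv : IsProbabilityMeasure v) (hvsupp : v (Set.Icc 0 1) = 1)
    (β : ℝ) (hβ : β ∈ Set.Ioo (0:ℝ) 1)
    (sol : DPSolution (Set.Icc lo hi) (fun _ => Set.Icc 0 abar)
      (fun f s a => a * D s a + β * ∫ γ, f (γ * s + (1 - γ) * a) ∂v))
    (hgmeas : Measurable sol.g)
    -- two initial reference prices `s₁(1) ≤ s₂(1)`
    (s₁ s₂ : ℝ) (hs₁ : s₁ ∈ Set.Icc lo hi) (hs₂ : s₂ ∈ Set.Icc lo hi)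
    (hs : s₁ ≤ s₂) :
    ∀ t : ℕ,
      ∫ s in Set.Icc lo hi, sol.g s
          ∂(iterDist (fun s => v.map fun γ => γ * s + (1 - γ) * sol.g s) s₂ t) ≥
        ∫ s in Set.Icc lo hi, sol.g s
          ∂(iterDist (fun s => v.map fun γ => γ * s + (1 - γ) * sol.g s) s₁ t) := by
  intro t
  have hA : Set.Icc 0 abar ⊆ Set.Icc lo hi := Set.Icc_subset_Icc hlo hhi
  have hβ₀ : 0 ≤ β := hβ.1.le
  obtain ⟨hW, hV⟩ := sol.monotoneOn_V fun n hn a ha =>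
    monotoneOn_pricing_return hA hvsupp hβ₀ ha (hDinc a ha) hn
  have hVc : ConvexOn ℝ (Set.Icc lo hi) sol.V :=
    sol.convexOn_V (convex_Icc lo hi) fun n hn a ha =>
      convexOn_pricing_return hA hvsupp hβ₀ ha (hDconv a ha) (hW n) hn
  have hg : MonotoneOn sol.g (Set.Icc lo hi) :=
    sol.monotoneOn_g fun x hx y hy a ha b hb hxy hab =>
      pricing_return_increasing_differences hA hvsupp hβ₀ hDinc hDid hV hVc hx hy ha hb hxy hab
  have hgA : ∀ s ∈ Set.Icc lo hi, sol.g s ∈ Set.Icc 0 abar := fun s hs => (sol.gmax s hs).1.1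
  have hφ : Measurable (Function.uncurry fun s γ : ℝ => γ * s + (1 - γ) * sol.g s) := by
    unfold Function.uncurry
    fun_prop
  have hprob := isProbabilityMeasure_iterDist_s12 (measurable_map_param (v := v) hφ)
    fun s => Measure.isProbabilityMeasure_map
      (hφ.comp (measurable_prodMk_left (x := s))).aemeasurable
  have hnonneg : ∀ μ : Measure ℝ, 0 ≤ᵐ[μ.restrict (Set.Icc lo hi)] sol.g := fun μ =>
    (ae_restrict_mem measurableSet_Icc).mono fun s hs => (hgA s hs).1
  have hmeas : Measurable fun s => ENNReal.ofReal (sol.g s) := hgmeas.ennreal_ofReal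
  rw [ge_iff_le, integral_eq_lintegral_of_nonneg_ae (hnonneg _) hgmeas.aestronglyMeasurable,
    integral_eq_lintegral_of_nonneg_ae (hnonneg _) hgmeas.aestronglyMeasurable]
  refine ENNReal.toReal_mono ?_ ?_
  · have := hprob s₂ t
    exact (setLIntegral_lt_top_of_le_nnreal (measure_ne_top _ _) ⟨abar.toNNReal, fun s hs =>
      ENNReal.ofReal_le_ofReal (hgA s hs).2⟩).ne
  · rw [← lintegral_indicator measurableSet_Icc, ← lintegral_indicator measurableSet_Icc]
    refine lintegral_iterDist_mono hφ ?_ ?_ hs₁ hs₂ hs t (hmeas.indicator measurableSet_Icc) ?_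
    · filter_upwards [ae_mem_unitInterval hvsupp] with γ hγ s hs
      exact mix_mem_Icc hγ hs (hA (hgA s hs))
    · filter_upwards [ae_mem_unitInterval hvsupp] with γ hγ x hx y hy hxy
      exact mix_le_mix hγ hxy (hg hx hy hxy)
    · intro x hx y hy hxy
      rw [Set.indicator_of_mem hx, Set.indicator_of_mem hy]
      exact ENNReal.ofReal_le_ofReal (hg hx hy hxy)
end
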